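/- Let d ≥ 2, let 1 ≤ k ≤ d/2 be an integer, and let α ∈ ℝ^d satisfy α_i ≥ α_{i+1} for all 1 ≤ i ≤ d−1 and Σ_{i=1}^d α_i = 0. Let m be any integer with 1 ≤ m ≤ d−2k+1 such that Σ_{i=1}^k α_{m+2(i−1)} ≥ 0 ≥ Σ_{i=1}^k α_{m+2i−1}. Then for every permutation w of {1,…,d}: h_k(w) − (k(d−k)/d)·(m+k−1)·ψ_k(w) ≤ h_G − k·Σ_{i=1}^m α_i − Σ_{i=1}^{k−1} (k−i)·(α_{m+2i−1} + α_{m+2i}). (This is the combinatorial content of Theorem 1.1: the right-hand side is the claimed upper bound for the entropy in the cusp region of the maximal parabolic subgroup P_k.) -/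

import Mathlib

/-- `h_k(w)`: the entropy of `diag(α_{w 1},…,α_{w d})` on the standard maximal
parabolic subgroup `P_k` of `SL_d(ℝ)`. -/
noncomputable def entk (d k : ℕ) (α : ℕ → ℝ) (w : ℕ → ℕ) : ℝ :=
    (∑ i ∈ Finset.Icc 1 k, ∑ j ∈ Finset.Icc 1 k, max (α (w i) - α (w j)) 0)
  + (∑ i ∈ Finset.Icc (k + 1) d, ∑ j ∈ Finset.Icc (k + 1) d, max (α (w i) - α (w j)) 0)
  + (∑ i ∈ Finset.Icc 1 k, ∑ j ∈ Finset.Icc (k + 1) d, max (α (w i) - α (w j)) 0)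

/-- `ψ_k(w) = (1/k) Σ_{i=1}^k α_{w i} − (1/(d−k)) Σ_{i=k+1}^d α_{w i}`. -/
noncomputable def psik (d k : ℕ) (α : ℕ → ℝ) (w : ℕ → ℕ) : ℝ :=
    (1 / (k : ℝ)) * ∑ i ∈ Finset.Icc 1 k, α (w i)
  - (1 / ((d : ℝ) - (k : ℝ))) * ∑ i ∈ Finset.Icc (k + 1) d, α (w i)

/-- `h_G = Σ_{1≤i,j≤d} (α_i − α_j)⁺`. -/
noncomputable def entG (d : ℕ) (α : ℕ → ℝ) : ℝ :=
  ∑ i ∈ Finset.Icc 1 d, ∑ j ∈ Finset.Icc 1 d, max (α i - α j) 0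

lemma aux_anti (d : ℕ) (α : ℕ → ℝ) (hmono : ∀ i ∈ Finset.Icc 1 (d - 1), α (i + 1) ≤ α i)
    (a b : ℕ) (ha : 1 ≤ a) (hab : a ≤ b) (hb : b ≤ d) : α b ≤ α a := by
  induction b, hab using Nat.le_induction with
  | base => exact le_rfl
  | succ n hn ih =>
    exact (hmono n (Finset.mem_Icc.2 ⟨by omega, by omega⟩)).trans (ih (by omega))

/-- The one-variable estimate: upward case. -/
lemma aux_up (d : ℕ) (α : ℕ → ℝ) (hmono : ∀ i ∈ Finset.Icc 1 (d - 1), α (i + 1) ≤ α i)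
    (x c : ℕ) (hx : 1 ≤ x) (hxc : x ≤ c) (hc : c ≤ d) :
    ∑ b ∈ Finset.Icc 1 c, α b ≤ ∑ b ∈ Finset.Icc 1 x, α b + ((c : ℝ) - x) * α x := by
  induction c, hxc using Nat.le_induction with
  | base => simp
  | succ n hn ih =>
    rw [Finset.sum_Icc_succ_top (by omega)]
    have := aux_anti d α hmono x (n + 1) hx (by omega) hc
    have := ih (by omega)
    push_cast
    linarith

lemma aux_down (d : ℕ) (α : ℕ → ℝ) (hmono : ∀ i ∈ Finset.Icc 1 (d - 1), α (i + 1) ≤ α i)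
    (x c : ℕ) (hxc : c ≤ x) (hc : x ≤ d) :
    ∑ b ∈ Finset.Icc 1 c, α b ≤ ∑ b ∈ Finset.Icc 1 x, α b + ((c : ℝ) - x) * α x := by
  suffices h : ∀ y, c ≤ y → y ≤ x →
      ∑ b ∈ Finset.Icc 1 c, α b ≤ ∑ b ∈ Finset.Icc 1 y, α b + ((c : ℝ) - y) * α x from
    h x hxc le_rfl
  intro y hy
  induction y, hy using Nat.le_induction with
  | base => simp
  | succ n hn ih =>
    intro hnx
    rw [Finset.sum_Icc_succ_top (by omega)]
    have := aux_anti d α hmono (n + 1) x (by omega) hnx hc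
    have := ih (by omega)
    push_cast
    linarith

lemma aux_g (d : ℕ) (α : ℕ → ℝ) (hmono : ∀ i ∈ Finset.Icc 1 (d - 1), α (i + 1) ≤ α i)
    (x c : ℕ) (hx : 1 ≤ x) (hxd : x ≤ d) (hc : c ≤ d) :
    ∑ b ∈ Finset.Icc 1 c, α b ≤ ∑ b ∈ Finset.Icc 1 x, α b + ((c : ℝ) - x) * α x := by
  rcases le_total x c with h | h
  · exact aux_up d α hmono x c hx h hc
  · exact aux_down d α hmono x c h hxd

lemma aux_row (d : ℕ) (α : ℕ → ℝ) (hmono : ∀ i ∈ Finset.Icc 1 (d - 1), α (i + 1) ≤ α i)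
    (x : ℕ) (hx : 1 ≤ x) (hxd : x ≤ d) :
    ∑ b ∈ Finset.Icc 1 d, max (α b - α x) 0 = ∑ b ∈ Finset.Icc 1 x, α b - x * α x := by
  have h1 : ∑ b ∈ Finset.Icc 1 d, max (α b - α x) 0
      = ∑ b ∈ Finset.Icc 1 x, max (α b - α x) 0 := by
    symm
    apply Finset.sum_subset
    · exact Finset.Icc_subset_Icc le_rfl hxd
    · intro b hb hb'
      simp only [Finset.mem_Icc] at hb hb'
      have := aux_anti d α hmono x b hx (by omega) hb.2
      exact max_eq_right (by linarith)
  rw [h1]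
  have h2 : ∑ b ∈ Finset.Icc 1 x, max (α b - α x) 0 = ∑ b ∈ Finset.Icc 1 x, (α b - α x) := by
    apply Finset.sum_congr rfl
    intro b hb
    simp only [Finset.mem_Icc] at hb
    have := aux_anti d α hmono b x hb.1 hb.2 hxd
    exact max_eq_left (by linarith)
  rw [h2, Finset.sum_sub_distrib]
  simp

lemma aux_main (d m : ℕ) (α : ℕ → ℝ) (hmono : ∀ i ∈ Finset.Icc 1 (d - 1), α (i + 1) ≤ α i)
    (A : Finset ℕ) : A ⊆ Finset.Icc 1 d → m + 2 * A.card ≤ d + 2 →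
    ∑ r ∈ Finset.range A.card, ∑ b ∈ Finset.Icc 1 (m + 2 * r), α b ≤
      ∑ a ∈ A, ∑ b ∈ Finset.Icc 1 d, max (α b - α a) 0
      - ∑ a ∈ A, ∑ b ∈ A, max (α b - α a) 0 + ((m : ℝ) + A.card - 1) * ∑ a ∈ A, α a := by
  induction A using Finset.induction_on_max with
  | empty => intro _ _; simp
  | insert x A hx ih =>
    intro hA hc
    have hxA : x ∉ A := fun h => lt_irrefl _ (hx x h)
    rw [Finset.card_insert_of_notMem hxA] at hc ⊢
    have hA' : A ⊆ Finset.Icc 1 d := fun a ha => hA (Finset.mem_insert_of_mem ha)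
    have hxm := Finset.mem_Icc.1 (hA (Finset.mem_insert_self x A))
    have ih' := ih hA' (by omega)
    have hg := aux_g d α hmono x (m + 2 * A.card) hxm.1 hxm.2 (by omega)
    have hr := aux_row d α hmono x hxm.1 hxm.2
    have e1 : ∑ b ∈ A, max (α b - α x) 0 = ∑ b ∈ A, α b - A.card * α x := by
      have : ∑ b ∈ A, max (α b - α x) 0 = ∑ b ∈ A, (α b - α x) := by
        apply Finset.sum_congr rfl
        intro b hb
        have := aux_anti d α hmono b x (Finset.mem_Icc.1 (hA' hb)).1 (hx b hb).le hxm.2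
        exact max_eq_left (by linarith)
      rw [this, Finset.sum_sub_distrib]
      simp
    have e2 : ∑ a ∈ A, max (α x - α a) 0 = 0 := by
      apply Finset.sum_eq_zero
      intro b hb
      have := aux_anti d α hmono b x (Finset.mem_Icc.1 (hA' hb)).1 (hx b hb).le hxm.2
      exact max_eq_right (by linarith)
    rw [Finset.sum_range_succ]
    simp only [Finset.sum_insert hxA, Finset.sum_add_distrib]
    rw [hr, e1, e2]
    simp only [sub_self, max_self]
    push_cast at hg ⊢
    linarith

lemma aux_rhs (m : ℕ) (hm : 1 ≤ m) (α : ℕ → ℝ) (k : ℕ) (hk : 1 ≤ k) :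
    ∑ r ∈ Finset.range k, ∑ b ∈ Finset.Icc 1 (m + 2 * r), α b =
      (k : ℝ) * (∑ i ∈ Finset.Icc 1 m, α i)
        + ∑ i ∈ Finset.Icc 1 (k - 1), ((k : ℝ) - (i : ℝ)) * (α (m + 2 * i - 1) + α (m + 2 * i)) := by
  have hG : ∀ r, ∑ b ∈ Finset.Icc 1 (m + 2 * r), α b = ∑ b ∈ Finset.Icc 1 m, α b +
      ∑ i ∈ Finset.Icc 1 r, (α (m + 2 * i - 1) + α (m + 2 * i)) := by
    intro r
    induction r with
    | zero => simp
    | succ r ih =>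
      rw [Finset.sum_Icc_succ_top (by omega : 1 ≤ r + 1),
        show m + 2 * (r + 1) = m + 2 * r + 1 + 1 by ring,
        Finset.sum_Icc_succ_top (by omega), Finset.sum_Icc_succ_top (by omega), ih]
      simp only [Nat.add_sub_cancel]
      ring
  induction k, hk using Nat.le_induction with
  | base => simp
  | succ n hn ih =>
    rw [Finset.sum_range_succ, ih, hG n]
    obtain ⟨p, rfl⟩ : ∃ p, n = p + 1 := ⟨n - 1, by omega⟩
    simp only [Nat.add_sub_cancel]
    have : ∑ i ∈ Finset.Icc 1 (p + 1), (((p + 1 + 1 : ℕ) : ℝ) - (i : ℝ)) *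
        (α (m + 2 * i - 1) + α (m + 2 * i)) =
        ∑ i ∈ Finset.Icc 1 (p + 1), (((p + 1 : ℕ) : ℝ) - (i : ℝ)) *
        (α (m + 2 * i - 1) + α (m + 2 * i)) +
        ∑ i ∈ Finset.Icc 1 (p + 1), (α (m + 2 * i - 1) + α (m + 2 * i)) := by
      rw [← Finset.sum_add_distrib]
      apply Finset.sum_congr rfl
      intro i _
      push_cast
      ring
    rw [this]
    have h0 : ∑ i ∈ Finset.Icc 1 (p + 1), (((p + 1 : ℕ) : ℝ) - (i : ℝ)) *
        (α (m + 2 * i - 1) + α (m + 2 * i)) = ∑ i ∈ Finset.Icc 1 p, (((p + 1 : ℕ) : ℝ) - (i : ℝ)) *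
        (α (m + 2 * i - 1) + α (m + 2 * i)) := by
      rw [Finset.sum_Icc_succ_top (by omega)]
      simp
    rw [h0]
    push_cast
    ring

lemma aux_split (k d : ℕ) (hkd : k ≤ d) (f : ℕ → ℝ) :
    ∑ i ∈ Finset.Icc 1 d, f i = ∑ i ∈ Finset.Icc 1 k, f i + ∑ i ∈ Finset.Icc (k + 1) d, f i := by
  rw [← Finset.sum_union]
  · congr 1
    ext i
    simp only [Finset.mem_Icc, Finset.mem_union]
    omega
  · rw [Finset.disjoint_left]
    intro i
    simp only [Finset.mem_Icc]
    omega

/-- The combinatorial content of Theorem 1.1: if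
`Σ_{i=1}^k α_{m+2(i−1)} ≥ 0 ≥ Σ_{i=1}^k α_{m+2i−1}` then for every permutation `w`,
`h_k(w) − (k(d−k)/d)(m+k−1)ψ_k(w)
  ≤ h_G − k Σ_{i=1}^m α_i − Σ_{i=1}^{k−1} (k−i)(α_{m+2i−1}+α_{m+2i})`. -/
theorem stmt_5 (d k m : ℕ) (hd : 2 ≤ d) (hk1 : 1 ≤ k) (hk2 : 2 * k ≤ d)
    (α : ℕ → ℝ) (hmono : ∀ i ∈ Finset.Icc 1 (d - 1), α (i + 1) ≤ α i)
    (hsum : ∑ i ∈ Finset.Icc 1 d, α i = 0)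
    (hm1 : 1 ≤ m) (hm2 : m ≤ d - 2 * k + 1)
    (hsgn1 : 0 ≤ ∑ i ∈ Finset.Icc 1 k, α (m + 2 * (i - 1)))
    (hsgn2 : ∑ i ∈ Finset.Icc 1 k, α (m + 2 * i - 1) ≤ 0)
    (w : Equiv.Perm ℕ) (hw : ∀ i ∈ Finset.Icc 1 d, w i ∈ Finset.Icc 1 d) :
    entk d k α ⇑w - ((k : ℝ) * ((d : ℝ) - (k : ℝ)) / (d : ℝ)) * ((m : ℝ) + (k : ℝ) - 1)
        * psik d k α ⇑w
      ≤ entG d α - (k : ℝ) * (∑ i ∈ Finset.Icc 1 m, α i)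
        - ∑ i ∈ Finset.Icc 1 (k - 1), ((k : ℝ) - (i : ℝ)) * (α (m + 2 * i - 1) + α (m + 2 * i)) := by
  have hkd : k ≤ d := by omega
  have himg : (Finset.Icc 1 d).image w = Finset.Icc 1 d := by
    apply Finset.eq_of_subset_of_card_le
    · intro x hx
      obtain ⟨i, hi, rfl⟩ := Finset.mem_image.1 hx
      exact hw i hi
    · rw [Finset.card_image_of_injective _ w.injective]
  have hre : ∀ f : ℕ → ℝ, ∑ i ∈ Finset.Icc 1 d, f (w i) = ∑ i ∈ Finset.Icc 1 d, f i := by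
    intro f
    conv_rhs => rw [← himg]
    rw [Finset.sum_image (fun a _ b _ h => w.injective h)]
  have hA : ∀ f : ℕ → ℝ, ∑ a ∈ (Finset.Icc 1 k).image w, f a = ∑ i ∈ Finset.Icc 1 k, f (w i) :=
    fun f => Finset.sum_image (fun a _ b _ h => w.injective h)
  have hcard : ((Finset.Icc 1 k).image w).card = k := by
    rw [Finset.card_image_of_injective _ w.injective]
    simp
  have hsub : (Finset.Icc 1 k).image w ⊆ Finset.Icc 1 d := by
    rw [← himg]
    exact Finset.image_subset_image (Finset.Icc_subset_Icc le_rfl hkd)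
  have key := aux_main d m α hmono _ hsub (by rw [hcard]; omega)
  rw [hcard, aux_rhs m hm1 α k hk1] at key
  simp only [hA] at key
  have hpsi : ((k : ℝ) * ((d : ℝ) - (k : ℝ)) / (d : ℝ)) * ((m : ℝ) + (k : ℝ) - 1)
        * psik d k α ⇑w = ((m : ℝ) + (k : ℝ) - 1) * ∑ i ∈ Finset.Icc 1 k, α (w i) := by
    have h0 := hre α
    rw [hsum, aux_split k d hkd] at h0
    have h1 : ∑ i ∈ Finset.Icc (k + 1) d, α (w i) = - ∑ i ∈ Finset.Icc 1 k, α (w i) := by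
      linarith
    unfold psik
    rw [h1]
    have hk0 : (k : ℝ) ≠ 0 := by
      have : (1 : ℝ) ≤ k := by exact_mod_cast hk1
      linarith
    have hd0 : (d : ℝ) ≠ 0 := by
      have : (2 : ℝ) ≤ d := by exact_mod_cast hd
      linarith
    have hdk : (d : ℝ) - k ≠ 0 := by
      have : (k : ℝ) < d := by exact_mod_cast (by omega : k < d)
      linarith
    field_simp
    ring
  have hent : entG d α - entk d k α ⇑w =
      ∑ j ∈ Finset.Icc 1 k, ∑ b ∈ Finset.Icc 1 d, max (α b - α (w j)) 0
      - ∑ j ∈ Finset.Icc 1 k, ∑ i ∈ Finset.Icc 1 k, max (α (w i) - α (w j)) 0 := by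
    have hG : entG d α = ∑ j ∈ Finset.Icc 1 d, ∑ i ∈ Finset.Icc 1 d,
        max (α (w i) - α (w j)) 0 := by
      unfold entG
      rw [Finset.sum_comm, ← hre (fun j => ∑ i ∈ Finset.Icc 1 d, max (α i - α j) 0)]
      apply Finset.sum_congr rfl
      intro j _
      exact (hre (fun i => max (α i - α (w j)) 0)).symm
    have hB : ∀ j, ∑ b ∈ Finset.Icc 1 d, max (α b - α (w j)) 0
        = ∑ i ∈ Finset.Icc 1 d, max (α (w i) - α (w j)) 0 :=
      fun j => (hre (fun i => max (α i - α (w j)) 0)).symm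
    rw [hG]
    unfold entk
    simp only [hB, aux_split k d hkd, Finset.sum_add_distrib]
    rw [Finset.sum_comm (s := Finset.Icc 1 k) (t := Finset.Icc (k + 1) d)
        (f := fun i j => max (α (w i) - α (w j)) 0),
      Finset.sum_comm (s := Finset.Icc (k + 1) d) (t := Finset.Icc (k + 1) d)
        (f := fun i j => max (α (w i) - α (w j)) 0),
      Finset.sum_comm (s := Finset.Icc 1 k) (t := Finset.Icc 1 k)
        (f := fun i j => max (α (w i) - α (w j)) 0)]
    ring
  rw [hpsi]
  linarith
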